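/- Let P = {y ∈ ℝⁿ : l_k(y) ≥ 0, k = 1,…,d} be a compact convex polytope with nonempty interior as in the Guillemin-form setup, and let u = u_G + F be of Guillemin form with F of class C¹ on an open neighborhood of P. Let y₀ ∈ ∂P be a boundary point such that the set of active normals {v_k : l_k(y₀) = 0} is linearly independent. Then for every sequence (w_i) of interior points of P converging to y₀, the gradients blow up: |∇u(w_i)| → ∞ as i → ∞. -/

import Mathlib

open scoped RealInnerProductSpace
open Set Filter

noncomputable section

/-- The affine-linear defining function `l_k(y) = ⟨y, v_k⟩ - λ_k` of the `k`-th facet. -/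
def ell {n d : ℕ} (v : Fin d → EuclideanSpace ℝ (Fin n)) (lam : Fin d → ℝ)
    (k : Fin d) (y : EuclideanSpace ℝ (Fin n)) : ℝ := ⟪y, v k⟫ - lam k

/-- The polytope `P = {y : l_k(y) ≥ 0, k = 1,…,d}`. -/
def poly {n d : ℕ} (v : Fin d → EuclideanSpace ℝ (Fin n)) (lam : Fin d → ℝ) :
    Set (EuclideanSpace ℝ (Fin n)) := {y | ∀ k, 0 ≤ ell v lam k y}

/-- The Guillemin potential `u_G(y) = Σ_k l_k(y) log l_k(y)` (with `0·log 0 = 0`,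
which holds by the convention `Real.log 0 = 0`). -/
def uG {n d : ℕ} (v : Fin d → EuclideanSpace ℝ (Fin n)) (lam : Fin d → ℝ)
    (y : EuclideanSpace ℝ (Fin n)) : ℝ :=
  ∑ k, ell v lam k y * Real.log (ell v lam k y)

/-- `P ∩ {l_k = 0}` is a facet of `P`: it is nonempty and its affine span has
dimension `n - 1`. -/
def IsFacet {n d : ℕ} (v : Fin d → EuclideanSpace ℝ (Fin n)) (lam : Fin d → ℝ)
    (k : Fin d) : Prop :=
  (poly v lam ∩ {y | ell v lam k y = 0}).Nonempty ∧
  Module.finrank ℝ (affineSpan ℝ (poly v lam ∩ {y | ell v lam k y = 0})).direction = n - 1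

lemma continuous_ell {n d : ℕ} (v : Fin d → EuclideanSpace ℝ (Fin n)) (lam : Fin d → ℝ)
    (k : Fin d) : Continuous (ell v lam k) := by
  unfold ell
  fun_prop

/-- Defining functions with nonzero normal are positive in the interior of the polytope. -/
lemma ell_pos_of_mem_interior {n d : ℕ} {v : Fin d → EuclideanSpace ℝ (Fin n)}
    {lam : Fin d → ℝ} {k : Fin d} (hvk : v k ≠ 0) {y : EuclideanSpace ℝ (Fin n)}
    (hy : y ∈ interior (poly v lam)) : 0 < ell v lam k y := by
  have hcont : Continuous fun t : ℝ => y - t • v k := by fun_prop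
  have hmem : ∀ᶠ t in nhds (0 : ℝ), y - t • v k ∈ poly v lam :=
    hcont.continuousAt.eventually_mem (by simpa using mem_interior_iff_mem_nhds.mp hy)
  obtain ⟨t, ht, ht0⟩ :=
    ((hmem.filter_mono nhdsWithin_le_nhds).and (self_mem_nhdsWithin (s := Ioi (0 : ℝ)))).exists
  have hle : 0 ≤ ell v lam k (y - t • v k) := ht k
  have hsq : 0 < t * ‖v k‖ ^ 2 := mul_pos ht0 (by positivity)
  simp only [ell, inner_sub_left, real_inner_smul_left, real_inner_self_eq_norm_sq] at hle ⊢
  linarith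

/-- Some defining function vanishes at each boundary point of the polytope. -/
lemma exists_ell_eq_zero_of_mem_frontier {n d : ℕ} {v : Fin d → EuclideanSpace ℝ (Fin n)}
    {lam : Fin d → ℝ} {y : EuclideanSpace ℝ (Fin n)} (hyP : y ∈ poly v lam)
    (hy : y ∈ frontier (poly v lam)) : ∃ k, ell v lam k y = 0 := by
  by_contra! hne
  refine hy.2 (mem_interior_iff_mem_nhds.mpr ?_)
  have hpos : ∀ᶠ z in nhds y, ∀ k, 0 < ell v lam k z :=
    eventually_all.mpr fun k => (continuous_ell v lam k).continuousAt.eventually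
      (lt_mem_nhds (lt_of_le_of_ne (hyP k) (hne k).symm))
  filter_upwards [hpos] with z hz k using (hz k).le

/-- A linearly independent family in a finite-dimensional inner product space can be given
arbitrary inner products with a single vector. -/
lemma LinearIndependent.exists_inner_eq {ι E : Type*} [NormedAddCommGroup E]
    [InnerProductSpace ℝ E] [FiniteDimensional ℝ E] {b : ι → E} (hb : LinearIndependent ℝ b)
    (c : ι → ℝ) : ∃ ξ : E, ∀ i, ⟪b i, ξ⟫ = c i := by
  obtain ⟨g, hg⟩ := LinearMap.exists_extend ((Module.Basis.span hb).constr ℝ c)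
  refine ⟨(InnerProductSpace.toDual ℝ E).symm g.toContinuousLinearMap, fun i => ?_⟩
  rw [real_inner_comm, InnerProductSpace.toDual_symm_apply]
  have h := LinearMap.congr_fun hg (Module.Basis.span hb i)
  rw [Module.Basis.constr_basis] at h
  simpa [Module.Basis.span_apply] using h

/-- The derivative of the Guillemin potential where all defining functions are nonzero. -/
lemma hasFDerivAt_uG {n d : ℕ} {v : Fin d → EuclideanSpace ℝ (Fin n)} {lam : Fin d → ℝ}
    {y : EuclideanSpace ℝ (Fin n)} (hy : ∀ k, ell v lam k y ≠ 0) :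
    HasFDerivAt (uG v lam)
      (∑ k, (Real.log (ell v lam k y) + 1) • innerSL ℝ (v k)) y := by
  refine HasFDerivAt.fun_sum fun k _ => ?_
  have hell : HasFDerivAt (ell v lam k) (innerSL ℝ (v k)) y := by
    have h := ((innerSL ℝ (v k)).hasFDerivAt (x := y)).sub_const (lam k)
    refine h.congr_of_eventuallyEq (Eventually.of_forall fun z => ?_)
    simp [ell, real_inner_comm]
  exact (Real.hasDerivAt_mul_log (hy k)).comp_hasFDerivAt y hell

/-- For a potential `u = u_G + F` of Guillemin form, at a boundary point
`y₀ ∈ ∂P` whose active normals are linearly independent, the gradient of `u` blows up along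
every sequence of interior points converging to `y₀`. -/
theorem gradient_blows_up_at_boundary
    (n d : ℕ) (v : Fin d → EuclideanSpace ℝ (Fin n)) (lam : Fin d → ℝ)
    (hv : ∀ k, v k ≠ 0)
    (hPc : IsCompact (poly v lam)) (hPint : (interior (poly v lam)).Nonempty)
    (hfacet : ∀ k, IsFacet v lam k)
    (F : EuclideanSpace ℝ (Fin n) → ℝ) (V : Set (EuclideanSpace ℝ (Fin n)))
    (hV : IsOpen V) (hPV : poly v lam ⊆ V) (hF : ContDiffOn ℝ 1 F V)
    (u : EuclideanSpace ℝ (Fin n) → ℝ) (hu : ∀ y, u y = uG v lam y + F y)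
    (y₀ : EuclideanSpace ℝ (Fin n)) (hy₀ : y₀ ∈ frontier (poly v lam))
    (hind : LinearIndependent ℝ (fun k : {k : Fin d // ell v lam k y₀ = 0} => v k.1)) :
    ∀ w : ℕ → EuclideanSpace ℝ (Fin n),
      (∀ i, w i ∈ interior (poly v lam)) → Tendsto w atTop (nhds y₀) →
      Tendsto (fun i => ‖gradient u (w i)‖) atTop atTop := by
  intro w hw hlim
  have hy₀P : y₀ ∈ poly v lam := hPc.isClosed.frontier_subset hy₀
  obtain ⟨k₀, hk₀⟩ := exists_ell_eq_zero_of_mem_frontier hy₀P hy₀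
  obtain ⟨ξ, hξ⟩ := hind.exists_inner_eq (Pi.single ⟨k₀, hk₀⟩ 1)
  have hξk₀ : ⟪v k₀, ξ⟫ = 1 := by simpa using hξ ⟨k₀, hk₀⟩
  have hξk : ∀ k ≠ k₀, ell v lam k y₀ = 0 → ⟪v k, ξ⟫ = 0 := fun k hk hk0 => by
    simpa [Pi.single_apply, hk] using hξ ⟨k, hk0⟩
  have hpos : ∀ i k, 0 < ell v lam k (w i) := fun i k => ell_pos_of_mem_interior (hv k) (hw i)
  have hell : ∀ k, Tendsto (fun i => ell v lam k (w i)) atTop (nhds (ell v lam k y₀)) :=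
    fun k => ((continuous_ell v lam k).tendsto y₀).comp hlim
  have hgrad : ∀ i, ⟪gradient u (w i), ξ⟫ = (Real.log (ell v lam k₀ (w i)) + 1) +
      (∑ k ∈ Finset.univ.erase k₀, (Real.log (ell v lam k (w i)) + 1) * ⟪v k, ξ⟫
        + fderiv ℝ F (w i) ξ) := fun i => by
    have hFd : DifferentiableAt ℝ F (w i) := (hF.differentiableOn one_ne_zero).differentiableAt
      (hV.mem_nhds (hPV (interior_subset (hw i))))
    have hud : HasFDerivAt u _ (w i) :=
      ((hasFDerivAt_uG fun k => (hpos i k).ne').add hFd.hasFDerivAt).congr_of_eventuallyEq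
        (Eventually.of_forall hu)
    rw [gradient, InnerProductSpace.toDual_symm_apply, hud.fderiv, ← add_assoc]
    simp only [add_apply, sum_apply, smul_apply, innerSL_apply_apply, smul_eq_mul]
    rw [← Finset.add_sum_erase _ _ (Finset.mem_univ k₀), hξk₀, mul_one]
  have hlog : Tendsto (fun i => Real.log (ell v lam k₀ (w i)) + 1) atTop atBot := by
    refine tendsto_atBot_add_const_right _ _ (Real.tendsto_log_nhdsGT_zero.comp ?_)
    exact tendsto_nhdsWithin_iff.mpr ⟨hk₀ ▸ hell k₀, Eventually.of_forall fun i => hpos i k₀⟩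
  have hsum : Tendsto
      (fun i => ∑ k ∈ Finset.univ.erase k₀, (Real.log (ell v lam k (w i)) + 1) * ⟪v k, ξ⟫) atTop
      (nhds (∑ k ∈ Finset.univ.erase k₀, (Real.log (ell v lam k y₀) + 1) * ⟪v k, ξ⟫)) := by
    refine tendsto_finsetSum _ fun k hk => ?_
    by_cases hk0 : ell v lam k y₀ = 0
    · simp [hξk k (Finset.ne_of_mem_erase hk) hk0]
    · exact (((hell k).log hk0).add_const 1).mul_const _
  have hFlim : Tendsto (fun i => fderiv ℝ F (w i) ξ) atTop (nhds (fderiv ℝ F y₀ ξ)) :=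
    (((hF.continuousOn_fderiv_of_isOpen hV le_rfl).continuousAt
      (hV.mem_nhds (hPV hy₀P))).clm_apply continuousAt_const).tendsto.comp hlim
  have hinner : Tendsto (fun i => |⟪gradient u (w i), ξ⟫|) atTop atTop := by
    simp only [hgrad]
    exact tendsto_abs_atBot_atTop.comp (hlog.atBot_add (hsum.add hFlim))
  have hξ0 : 0 < ‖ξ‖ := norm_pos_iff.mpr fun h => by simp [h] at hξk₀
  refine (tendsto_mul_const_atTop_of_pos hξ0).mp (tendsto_atTop_mono (fun i => ?_) hinner)
  exact abs_real_inner_le_norm _ _
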